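/- For each fixed i ∈ {1,2,3}, the five functions I₀ᵢ, I₁₂, I₂₃, I₁₂₃ and H^SW are functionally independent on D; that is, there exists a point of D at which their five gradients (vectors in ℝ⁶) are linearly independent. Consequently H^SW is a maximally superintegrable Hamiltonian. -/

import Mathlib

namespace Paper
noncomputable section

/-- The κ-dependent cosine Cκ(x) = ∑ (−κ)^l x^{2l}/(2l)!. -/
def Ck (κ x : ℝ) : ℝ := ∑' l : ℕ, (-κ) ^ l * x ^ (2 * l) / (Nat.factorial (2 * l) : ℝ)

/-- The κ-dependent sine Sκ(x) = ∑ (−κ)^l x^{2l+1}/(2l+1)!. -/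
def Sk (κ x : ℝ) : ℝ := ∑' l : ℕ, (-κ) ^ l * x ^ (2 * l + 1) / (Nat.factorial (2 * l + 1) : ℝ)

/-- The κ-dependent tangent Tκ(x) = Sκ(x)/Cκ(x). -/
def Tk (κ x : ℝ) : ℝ := Sk κ x / Ck κ x

/-- Phase space ℝ³ × ℝ³ ≃ ℝ⁶ with canonical coordinates
`(r, θ, φ, p_r, p_θ, p_φ) = (x 0, x 1, x 2, x 3, x 4, x 5)`. -/
abbrev Pt := Fin 6 → ℝ

/-- Partial derivative in the i-th coordinate direction. -/
def pd (f : Pt → ℝ) (i : Fin 6) (x : Pt) : ℝ := fderiv ℝ f x (Pi.single i 1)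

/-- Canonical Poisson bracket {f,g} = ∑_{q} (∂f/∂q ∂g/∂p_q − ∂g/∂q ∂f/∂p_q). -/
def pb (f g : Pt → ℝ) (x : Pt) : ℝ :=
  ∑ i : Fin 3,
    (pd f ⟨i.1, by omega⟩ x * pd g ⟨i.1 + 3, by omega⟩ x
      - pd g ⟨i.1, by omega⟩ x * pd f ⟨i.1 + 3, by omega⟩ x)

/-- Gradient of a function on phase space, as a vector in ℝ⁶. -/
def grad (f : Pt → ℝ) (x : Pt) : Fin 6 → ℝ := fun i => pd f i x

/-- The open domain D where Sκ₁(r), Cκ₁(r), Sκ₂(θ), Cκ₂(θ), cos φ, sin φ are nonzero. -/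
def D (κ₁ κ₂ : ℝ) : Set Pt :=
  {x | Sk κ₁ (x 0) ≠ 0 ∧ Ck κ₁ (x 0) ≠ 0 ∧ Sk κ₂ (x 1) ≠ 0 ∧ Ck κ₂ (x 1) ≠ 0 ∧
       Real.cos (x 2) ≠ 0 ∧ Real.sin (x 2) ≠ 0}

/-- J₀₁ = Cκ₂(θ)p_r − (Sκ₂(θ)/Tκ₁(r))p_θ. -/
def J01 (κ₁ κ₂ : ℝ) (x : Pt) : ℝ :=
  Ck κ₂ (x 1) * x 3 - (Sk κ₂ (x 1) / Tk κ₁ (x 0)) * x 4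

/-- J₀₂. -/
def J02 (κ₁ κ₂ : ℝ) (x : Pt) : ℝ :=
  κ₂ * Sk κ₂ (x 1) * Real.cos (x 2) * x 3
    + (Ck κ₂ (x 1) * Real.cos (x 2) / Tk κ₁ (x 0)) * x 4
    - (Real.sin (x 2) / (Tk κ₁ (x 0) * Sk κ₂ (x 1))) * x 5

/-- J₀₃. -/
def J03 (κ₁ κ₂ : ℝ) (x : Pt) : ℝ :=
  κ₂ * Sk κ₂ (x 1) * Real.sin (x 2) * x 3
    + (Ck κ₂ (x 1) * Real.sin (x 2) / Tk κ₁ (x 0)) * x 4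
    + (Real.cos (x 2) / (Tk κ₁ (x 0) * Sk κ₂ (x 1))) * x 5

/-- J₁₂ = cos φ·p_θ − (sin φ/Tκ₂(θ))p_φ. -/
def J12 (κ₂ : ℝ) (x : Pt) : ℝ :=
  Real.cos (x 2) * x 4 - (Real.sin (x 2) / Tk κ₂ (x 1)) * x 5

/-- J₁₃ = sin φ·p_θ + (cos φ/Tκ₂(θ))p_φ. -/
def J13 (κ₂ : ℝ) (x : Pt) : ℝ :=
  Real.sin (x 2) * x 4 + (Real.cos (x 2) / Tk κ₂ (x 1)) * x 5

/-- J₂₃ = p_φ. -/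
def J23 (x : Pt) : ℝ := x 5

/-- Kinetic energy T. -/
def Tkin (κ₁ κ₂ : ℝ) (x : Pt) : ℝ :=
  (1 / 2) * ((x 3) ^ 2 + (x 4) ^ 2 / (κ₂ * Sk κ₁ (x 0) ^ 2)
    + (x 5) ^ 2 / (κ₂ * Sk κ₁ (x 0) ^ 2 * Sk κ₂ (x 1) ^ 2))

/-- The superintegrable potential U with arbitrary radial function F. -/
def U (κ₁ κ₂ : ℝ) (F : ℝ → ℝ) (β₁ β₂ β₃ : ℝ) (x : Pt) : ℝ :=
  F (x 0) + (1 / Sk κ₁ (x 0) ^ 2) *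
    (β₁ / Ck κ₂ (x 1) ^ 2 + β₂ / (Sk κ₂ (x 1) ^ 2 * Real.cos (x 2) ^ 2)
      + β₃ / (Sk κ₂ (x 1) ^ 2 * Real.sin (x 2) ^ 2))

/-- Integral I₁₂. -/
def I12 (κ₂ β₁ β₂ : ℝ) (x : Pt) : ℝ :=
  (Real.cos (x 2) * x 4 - (Real.sin (x 2) / Tk κ₂ (x 1)) * x 5) ^ 2
    + 2 * β₁ * κ₂ ^ 2 * Tk κ₂ (x 1) ^ 2 * Real.cos (x 2) ^ 2
    + 2 * β₂ * κ₂ / (Tk κ₂ (x 1) ^ 2 * Real.cos (x 2) ^ 2)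

/-- Integral I₁₃. -/
def I13 (κ₂ β₁ β₃ : ℝ) (x : Pt) : ℝ :=
  (Real.sin (x 2) * x 4 + (Real.cos (x 2) / Tk κ₂ (x 1)) * x 5) ^ 2
    + 2 * β₁ * κ₂ ^ 2 * Tk κ₂ (x 1) ^ 2 * Real.sin (x 2) ^ 2
    + 2 * β₃ * κ₂ / (Tk κ₂ (x 1) ^ 2 * Real.sin (x 2) ^ 2)

/-- Integral I₂₃. -/
def I23 (κ₂ β₂ β₃ : ℝ) (x : Pt) : ℝ :=
  (x 5) ^ 2 + 2 * β₂ * κ₂ * Real.tan (x 2) ^ 2 + 2 * β₃ * κ₂ / Real.tan (x 2) ^ 2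

/-- Integral I₁₂₃. -/
def I123 (κ₂ β₁ β₂ β₃ : ℝ) (x : Pt) : ℝ :=
  (x 4) ^ 2 + (x 5) ^ 2 / Sk κ₂ (x 1) ^ 2 + 2 * β₁ * κ₂ / Ck κ₂ (x 1) ^ 2
    + 2 * β₂ * κ₂ / (Sk κ₂ (x 1) ^ 2 * Real.cos (x 2) ^ 2)
    + 2 * β₃ * κ₂ / (Sk κ₂ (x 1) ^ 2 * Real.sin (x 2) ^ 2)

/-- The Smorodinsky–Winternitz Hamiltonian H^SW. -/
def HSW (κ₁ κ₂ β₀ β₁ β₂ β₃ : ℝ) (x : Pt) : ℝ :=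
  Tkin κ₁ κ₂ x + β₀ * Tk κ₁ (x 0) ^ 2 + (1 / Sk κ₁ (x 0) ^ 2) *
    (β₁ / Ck κ₂ (x 1) ^ 2 + β₂ / (Sk κ₂ (x 1) ^ 2 * Real.cos (x 2) ^ 2)
      + β₃ / (Sk κ₂ (x 1) ^ 2 * Real.sin (x 2) ^ 2))

/-- Integral I₀₁ of H^SW. -/
def I01 (κ₁ κ₂ β₀ β₁ : ℝ) (x : Pt) : ℝ :=
  J01 κ₁ κ₂ x ^ 2 + 2 * β₀ * Tk κ₁ (x 0) ^ 2 * Ck κ₂ (x 1) ^ 2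
    + 2 * β₁ / (Tk κ₁ (x 0) ^ 2 * Ck κ₂ (x 1) ^ 2)

/-- Integral I₀₂ of H^SW. -/
def I02 (κ₁ κ₂ β₀ β₂ : ℝ) (x : Pt) : ℝ :=
  J02 κ₁ κ₂ x ^ 2 + 2 * β₀ * κ₂ ^ 2 * Tk κ₁ (x 0) ^ 2 * Sk κ₂ (x 1) ^ 2 * Real.cos (x 2) ^ 2
    + 2 * β₂ * κ₂ / (Tk κ₁ (x 0) ^ 2 * Sk κ₂ (x 1) ^ 2 * Real.cos (x 2) ^ 2)

/-- Integral I₀₃ of H^SW. -/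
def I03 (κ₁ κ₂ β₀ β₃ : ℝ) (x : Pt) : ℝ :=
  J03 κ₁ κ₂ x ^ 2 + 2 * β₀ * κ₂ ^ 2 * Tk κ₁ (x 0) ^ 2 * Sk κ₂ (x 1) ^ 2 * Real.sin (x 2) ^ 2
    + 2 * β₃ * κ₂ / (Tk κ₁ (x 0) ^ 2 * Sk κ₂ (x 1) ^ 2 * Real.sin (x 2) ^ 2)

/-- Generalized Kepler–Coulomb Hamiltonian H^GKC₁ = T + U^GKC₁. -/
def HGKC1 (κ₁ κ₂ k β₂ β₃ : ℝ) (x : Pt) : ℝ :=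
  Tkin κ₁ κ₂ x - k / Tk κ₁ (x 0)
    + (1 / (Sk κ₁ (x 0) ^ 2 * Sk κ₂ (x 1) ^ 2)) *
        (β₂ / Real.cos (x 2) ^ 2 + β₃ / Real.sin (x 2) ^ 2)

/-- Generalized Kepler–Coulomb Hamiltonian H^GKC₂ = T + U^GKC₂. -/
def HGKC2 (κ₁ κ₂ k β₁ β₃ : ℝ) (x : Pt) : ℝ :=
  Tkin κ₁ κ₂ x - k / Tk κ₁ (x 0)
    + (1 / Sk κ₁ (x 0) ^ 2) *
        (β₁ / Ck κ₂ (x 1) ^ 2 + β₃ / (Sk κ₂ (x 1) ^ 2 * Real.sin (x 2) ^ 2))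

/-- Generalized Kepler–Coulomb Hamiltonian H^GKC₃ = T + U^GKC₃. -/
def HGKC3 (κ₁ κ₂ k β₁ β₂ : ℝ) (x : Pt) : ℝ :=
  Tkin κ₁ κ₂ x - k / Tk κ₁ (x 0)
    + (1 / Sk κ₁ (x 0) ^ 2) *
        (β₁ / Ck κ₂ (x 1) ^ 2 + β₂ / (Sk κ₂ (x 1) ^ 2 * Real.cos (x 2) ^ 2))

/-- The function L₁. -/
def L1 (κ₁ κ₂ k β₂ β₃ : ℝ) (x : Pt) : ℝ :=
  -(J02 κ₁ κ₂ x * J12 κ₂ x) - J03 κ₁ κ₂ x * J13 κ₂ x + k * κ₂ * Ck κ₂ (x 1)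
    - (2 * κ₂ * Ck κ₂ (x 1) / (Tk κ₁ (x 0) * Sk κ₂ (x 1) ^ 2)) *
        (β₂ / Real.cos (x 2) ^ 2 + β₃ / Real.sin (x 2) ^ 2)

/-- The function L₂. -/
def L2 (κ₁ κ₂ k β₁ β₃ : ℝ) (x : Pt) : ℝ :=
  J01 κ₁ κ₂ x * J12 κ₂ x - J03 κ₁ κ₂ x * J23 x + k * κ₂ * Sk κ₂ (x 1) * Real.cos (x 2)
    - (2 * κ₂ * Real.cos (x 2) / Tk κ₁ (x 0)) *
        (β₁ * Sk κ₂ (x 1) / Ck κ₂ (x 1) ^ 2 + β₃ / (Sk κ₂ (x 1) * Real.sin (x 2) ^ 2))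

/-- The function L₃. -/
def L3 (κ₁ κ₂ k β₁ β₂ : ℝ) (x : Pt) : ℝ :=
  J01 κ₁ κ₂ x * J13 κ₂ x + J02 κ₁ κ₂ x * J23 x + k * κ₂ * Sk κ₂ (x 1) * Real.sin (x 2)
    - (2 * κ₂ * Real.sin (x 2) / Tk κ₁ (x 0)) *
        (β₁ * Sk κ₂ (x 1) / Ck κ₂ (x 1) ^ 2 + β₂ / (Sk κ₂ (x 1) * Real.cos (x 2) ^ 2))

theorem sk_ck_eq_of_sq (w : ℝ) (hw : w ≠ 0) :
    Sk (w ^ 2) = (fun x => Real.sin (w * x) / w) ∧ Ck (w ^ 2) = fun x => Real.cos (w * x) := by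
  constructor <;> funext x
  · rw [← ((Real.hasSum_sin (w * x)).div_const w).tsum_eq]
    refine tsum_congr fun l => ?_
    rw [neg_pow (w ^ 2), ← pow_mul, mul_pow]
    field_simp
    ring
  · rw [← (Real.hasSum_cos (w * x)).tsum_eq]
    refine tsum_congr fun l => ?_
    rw [neg_pow (w ^ 2), ← pow_mul, mul_pow]
    ring

theorem sk_ck_eq_of_neg_sq (w : ℝ) (hw : w ≠ 0) :
    Sk (-w ^ 2) = (fun x => Real.sinh (w * x) / w) ∧
      Ck (-w ^ 2) = fun x => Real.cosh (w * x) := by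
  constructor <;> funext x
  · rw [← ((Real.hasSum_sinh (w * x)).div_const w).tsum_eq]
    refine tsum_congr fun l => ?_
    rw [neg_neg, ← pow_mul, mul_pow]
    field_simp
    ring
  · rw [← (Real.hasSum_cosh (w * x)).tsum_eq]
    refine tsum_congr fun l => ?_
    rw [neg_neg, ← pow_mul, mul_pow]

theorem sk_ck_eq_of_zero : Sk 0 = (fun x => x) ∧ Ck 0 = fun _ => 1 := by
  constructor <;> funext x
  · rw [Sk, tsum_eq_single 0 (fun l hl => by simp [hl])]
    simp
  · rw [Ck, tsum_eq_single 0 (fun l hl => by simp [hl])]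
    simp

theorem hasDerivAt_sk_ck (κ x : ℝ) :
    HasDerivAt (Sk κ) (Ck κ x) x ∧ HasDerivAt (Ck κ) (-κ * Sk κ x) x := by
  have hlin (w : ℝ) : HasDerivAt (fun y => w * y) w x := by
    simpa using (hasDerivAt_id x).const_mul w
  rcases lt_trichotomy κ 0 with h | rfl | h
  · obtain ⟨w, hw, rfl⟩ : ∃ w : ℝ, w ≠ 0 ∧ κ = -w ^ 2 :=
      ⟨√(-κ), (Real.sqrt_pos.2 (by linarith)).ne', by rw [Real.sq_sqrt (by linarith)]; ring⟩
    rw [(sk_ck_eq_of_neg_sq w hw).1, (sk_ck_eq_of_neg_sq w hw).2]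
    refine ⟨((hlin w).sinh.div_const w).congr_deriv ?_, (hlin w).cosh.congr_deriv ?_⟩ <;> field_simp
  · rw [sk_ck_eq_of_zero.1, sk_ck_eq_of_zero.2]
    exact ⟨hasDerivAt_id x, by simpa using hasDerivAt_const x (1 : ℝ)⟩
  · obtain ⟨w, hw, rfl⟩ : ∃ w : ℝ, w ≠ 0 ∧ κ = w ^ 2 :=
      ⟨√κ, (Real.sqrt_pos.2 h).ne', by rw [Real.sq_sqrt h.le]⟩
    rw [(sk_ck_eq_of_sq w hw).1, (sk_ck_eq_of_sq w hw).2]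
    refine ⟨((hlin w).sin.div_const w).congr_deriv ?_, (hlin w).cos.congr_deriv ?_⟩ <;> field_simp

theorem hasDerivAt_sk (κ x : ℝ) : HasDerivAt (Sk κ) (Ck κ x) x := (hasDerivAt_sk_ck κ x).1

theorem hasDerivAt_ck (κ x : ℝ) : HasDerivAt (Ck κ) (-κ * Sk κ x) x := (hasDerivAt_sk_ck κ x).2

@[fun_prop]
theorem differentiable_sk (κ : ℝ) : Differentiable ℝ (Sk κ) :=
  fun x => (hasDerivAt_sk κ x).differentiableAt

@[fun_prop]
theorem differentiable_ck (κ : ℝ) : Differentiable ℝ (Ck κ) :=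
  fun x => (hasDerivAt_ck κ x).differentiableAt

theorem sk_zero (κ : ℝ) : Sk κ 0 = 0 := by simp [Sk]

theorem ck_zero (κ : ℝ) : Ck κ 0 = 1 := by
  rw [Ck, tsum_eq_single 0 (fun l hl => by simp [hl])]
  simp

theorem ck_sq_add_sk_sq (κ x : ℝ) : Ck κ x ^ 2 + κ * Sk κ x ^ 2 = 1 := by
  have h (y : ℝ) : HasDerivAt (fun y => Ck κ y ^ 2 + κ * Sk κ y ^ 2) 0 y :=
    (((hasDerivAt_ck κ y).pow 2).add (((hasDerivAt_sk κ y).pow 2).const_mul κ)).congr_deriv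
      (by push_cast; ring)
  rw [is_const_of_deriv_eq_zero (fun y => (h y).differentiableAt) (fun y => (h y).deriv) x 0]
  simp [sk_zero, ck_zero]

theorem exists_sk_ne_zero_and_ck_ne_zero (κ : ℝ) : ∃ x, Sk κ x ≠ 0 ∧ Ck κ x ≠ 0 := by
  have hS : ∀ᶠ x in nhdsWithin 0 {0}ᶜ, Sk κ x ≠ 0 :=
    (hasDerivAt_sk κ 0).eventually_ne (by simp [ck_zero])
  have hC : ∀ᶠ x in nhdsWithin 0 {0}ᶜ, Ck κ x ≠ 0 :=
    ((differentiable_ck κ).continuous.continuousAt.eventually_ne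
      (by simp [ck_zero])).filter_mono nhdsWithin_le_nhds
  exact (hS.and hC).exists

theorem hasDerivAt_inv_tk {κ x : ℝ} (hS : Sk κ x ≠ 0) :
    HasDerivAt (fun y => 1 / Tk κ y) (-(1 / Sk κ x ^ 2)) x := by
  have h : (fun y => 1 / Tk κ y) = fun y => Ck κ y / Sk κ y := by
    funext y
    rw [Tk, one_div_div]
  rw [h]
  refine ((hasDerivAt_ck κ x).div (hasDerivAt_sk κ x) hS).congr_deriv ?_
  field_simp
  linear_combination -ck_sq_add_sk_sq κ x

theorem pd_eq_of_hasDerivAt {f : Pt → ℝ} {i : Fin 6} {x : Pt} {d : ℝ}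
    (hf : DifferentiableAt ℝ f x)
    (h : HasDerivAt (fun t => f (Function.update x i t)) d (x i)) : pd f i x = d := by
  have hf' : HasFDerivAt f (fderiv ℝ f x) (Function.update x i (x i)) := by
    rw [Function.update_eq_self]
    exact hf.hasFDerivAt
  exact (hf'.comp_hasDerivAt (x i) (hasDerivAt_update x i (x i))).unique h

theorem pd_eq_zero_of_update {f : Pt → ℝ} {i : Fin 6}
    (h : ∀ x t, f (Function.update x i t) = f x) (x : Pt) : pd f i x = 0 := by
  by_cases hf : DifferentiableAt ℝ f x
  · refine pd_eq_of_hasDerivAt hf ?_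
    simp only [h]
    exact hasDerivAt_const _ _
  · simp [pd, fderiv_zero_of_not_differentiableAt hf]

theorem linearIndependent_of_sparse {a b c d e : Fin 6 → ℝ}
    (ha : a 3 ≠ 0) (hb3 : b 3 = 0) (hc3 : c 3 = 0) (hd3 : d 3 = 0) (he3 : e 3 = 0)
    (hb0 : b 0 = 0) (hc0 : c 0 = 0) (hd0 : d 0 = 0) (he0 : e 0 ≠ 0)
    (hc1 : c 1 = 0) (hc4 : c 4 = 0) (hc5 : c 5 ≠ 0) (hdet : b 1 * d 4 - b 4 * d 1 ≠ 0) :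
    LinearIndependent ℝ ![a, b, c, d, e] := by
  rw [Fintype.linearIndependent_iff]
  intro g hg
  have hcoord (j : Fin 6) :
      g 0 * a j + g 1 * b j + g 2 * c j + g 3 * d j + g 4 * e j = 0 := by
    simpa [Fin.sum_univ_five] using congrFun hg j
  have h0 : g 0 = 0 := by simpa [*] using hcoord 3
  have h4 : g 4 = 0 := by simpa [*] using hcoord 0
  have hθ : g 1 * b 1 + g 3 * d 1 = 0 := by simpa [h0, h4, hc1] using hcoord 1
  have hp : g 1 * b 4 + g 3 * d 4 = 0 := by simpa [h0, h4, hc4] using hcoord 4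
  have h1 : g 1 = 0 := (mul_eq_zero.1
    (show g 1 * (b 1 * d 4 - b 4 * d 1) = 0 by linear_combination d 4 * hθ - d 1 * hp)).resolve_right
    hdet
  have h3 : g 3 = 0 := (mul_eq_zero.1
    (show g 3 * (b 1 * d 4 - b 4 * d 1) = 0 by linear_combination b 1 * hp - b 4 * hθ)).resolve_right
    hdet
  have h2 : g 2 = 0 := by simpa [h0, h1, h3, h4, hc5] using hcoord 5
  intro i
  fin_cases i <;> assumption

theorem eventually_quadratic_ne_zero {a b c : ℝ} (h : a ≠ 0 ∨ b ≠ 0) :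
    ∀ᶠ x in Filter.atTop, a * x ^ 2 + b * x + c ≠ 0 := by
  open Polynomial in
  have hP : (C a * X ^ 2 + C b * X + C c : ℝ[X]) ≠ 0 := by
    intro h0
    rcases h with h | h
    · exact h (by simpa [coeff_X, coeff_C] using congrArg (coeff · 2) h0)
    · exact h (by simpa [coeff_X, coeff_C] using congrArg (coeff · 1) h0)
  filter_upwards [Polynomial.eventually_atTop_not_isRoot _ hP] with x hx
  simpa [Polynomial.IsRoot] using hx

section Gradients

variable {κ₁ κ₂ : ℝ} {x : Pt}

theorem differentiableAt_I01 (hx : x ∈ D κ₁ κ₂) (β₀ β₁ : ℝ) :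
    DifferentiableAt ℝ (I01 κ₁ κ₂ β₀ β₁) x := by
  obtain ⟨h1, h2, h3, h4, h5, h6⟩ := hx
  unfold I01 J01 Tk
  fun_prop (disch := simp [*])

theorem differentiableAt_I02 (hx : x ∈ D κ₁ κ₂) (β₀ β₂ : ℝ) :
    DifferentiableAt ℝ (I02 κ₁ κ₂ β₀ β₂) x := by
  obtain ⟨h1, h2, h3, h4, h5, h6⟩ := hx
  unfold I02 J02 Tk
  fun_prop (disch := simp [*])

theorem differentiableAt_I03 (hx : x ∈ D κ₁ κ₂) (β₀ β₃ : ℝ) :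
    DifferentiableAt ℝ (I03 κ₁ κ₂ β₀ β₃) x := by
  obtain ⟨h1, h2, h3, h4, h5, h6⟩ := hx
  unfold I03 J03 Tk
  fun_prop (disch := simp [*])

theorem differentiableAt_I12 (hx : x ∈ D κ₁ κ₂) (β₁ β₂ : ℝ) :
    DifferentiableAt ℝ (I12 κ₂ β₁ β₂) x := by
  obtain ⟨h1, h2, h3, h4, h5, h6⟩ := hx
  unfold I12 Tk
  fun_prop (disch := simp [*])

theorem differentiableAt_I23 (hx : x ∈ D κ₁ κ₂) (β₂ β₃ : ℝ) :
    DifferentiableAt ℝ (I23 κ₂ β₂ β₃) x := by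
  obtain ⟨h1, h2, h3, h4, h5, h6⟩ := hx
  unfold I23
  simp only [Real.tan_eq_sin_div_cos]
  fun_prop (disch := simp [*])

theorem differentiableAt_I123 (hx : x ∈ D κ₁ κ₂) (β₁ β₂ β₃ : ℝ) :
    DifferentiableAt ℝ (I123 κ₂ β₁ β₂ β₃) x := by
  obtain ⟨h1, h2, h3, h4, h5, h6⟩ := hx
  unfold I123
  fun_prop (disch := simp [*])

theorem differentiableAt_HSW (hκ₂ : κ₂ ≠ 0) (hx : x ∈ D κ₁ κ₂) (β₀ β₁ β₂ β₃ : ℝ) :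
    DifferentiableAt ℝ (HSW κ₁ κ₂ β₀ β₁ β₂ β₃) x := by
  obtain ⟨h1, h2, h3, h4, h5, h6⟩ := hx
  unfold HSW Tkin Tk
  fun_prop (disch := simp [*])

theorem hasDerivAt_affine_sq_add (a b c t : ℝ) :
    HasDerivAt (fun s => (a * s + b) ^ 2 + c) (2 * (a * t + b) * a) t := by
  have h : HasDerivAt (fun s => a * s + b) a t := by
    simpa using ((hasDerivAt_id t).const_mul a).add_const b
  exact ((h.pow 2).add_const c).congr_deriv (by push_cast; ring)

theorem pd_three_I01 (hx : x ∈ D κ₁ κ₂) (β₀ β₁ : ℝ) :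
    pd (I01 κ₁ κ₂ β₀ β₁) 3 x = 2 * J01 κ₁ κ₂ x * Ck κ₂ (x 1) := by
  refine pd_eq_of_hasDerivAt (differentiableAt_I01 hx β₀ β₁) ?_
  convert hasDerivAt_affine_sq_add (Ck κ₂ (x 1)) (-(Sk κ₂ (x 1) / Tk κ₁ (x 0) * x 4))
    (2 * β₀ * Tk κ₁ (x 0) ^ 2 * Ck κ₂ (x 1) ^ 2
      + 2 * β₁ / (Tk κ₁ (x 0) ^ 2 * Ck κ₂ (x 1) ^ 2)) (x 3) using 1
  · funext t
    simp [I01, J01]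
    ring
  · rw [J01]
    ring

theorem pd_three_I02 (hx : x ∈ D κ₁ κ₂) (β₀ β₂ : ℝ) :
    pd (I02 κ₁ κ₂ β₀ β₂) 3 x
      = 2 * J02 κ₁ κ₂ x * (κ₂ * Sk κ₂ (x 1) * Real.cos (x 2)) := by
  refine pd_eq_of_hasDerivAt (differentiableAt_I02 hx β₀ β₂) ?_
  convert hasDerivAt_affine_sq_add (κ₂ * Sk κ₂ (x 1) * Real.cos (x 2))
    ((Ck κ₂ (x 1) * Real.cos (x 2) / Tk κ₁ (x 0)) * x 4
      - (Real.sin (x 2) / (Tk κ₁ (x 0) * Sk κ₂ (x 1))) * x 5)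
    (2 * β₀ * κ₂ ^ 2 * Tk κ₁ (x 0) ^ 2 * Sk κ₂ (x 1) ^ 2 * Real.cos (x 2) ^ 2
      + 2 * β₂ * κ₂ / (Tk κ₁ (x 0) ^ 2 * Sk κ₂ (x 1) ^ 2 * Real.cos (x 2) ^ 2)) (x 3) using 1
  · funext t
    simp [I02, J02]
    ring
  · rw [J02]
    ring

theorem pd_three_I03 (hx : x ∈ D κ₁ κ₂) (β₀ β₃ : ℝ) :
    pd (I03 κ₁ κ₂ β₀ β₃) 3 x
      = 2 * J03 κ₁ κ₂ x * (κ₂ * Sk κ₂ (x 1) * Real.sin (x 2)) := by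
  refine pd_eq_of_hasDerivAt (differentiableAt_I03 hx β₀ β₃) ?_
  convert hasDerivAt_affine_sq_add (κ₂ * Sk κ₂ (x 1) * Real.sin (x 2))
    ((Ck κ₂ (x 1) * Real.sin (x 2) / Tk κ₁ (x 0)) * x 4
      + (Real.cos (x 2) / (Tk κ₁ (x 0) * Sk κ₂ (x 1))) * x 5)
    (2 * β₀ * κ₂ ^ 2 * Tk κ₁ (x 0) ^ 2 * Sk κ₂ (x 1) ^ 2 * Real.sin (x 2) ^ 2
      + 2 * β₃ * κ₂ / (Tk κ₁ (x 0) ^ 2 * Sk κ₂ (x 1) ^ 2 * Real.sin (x 2) ^ 2)) (x 3) using 1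
  · funext t
    simp [I03, J03]
    ring
  · rw [J03]
    ring

theorem pd_three_HSW (hκ₂ : κ₂ ≠ 0) (hx : x ∈ D κ₁ κ₂) (β₀ β₁ β₂ β₃ : ℝ) :
    pd (HSW κ₁ κ₂ β₀ β₁ β₂ β₃) 3 x = x 3 := by
  refine pd_eq_of_hasDerivAt (differentiableAt_HSW hκ₂ hx β₀ β₁ β₂ β₃) ?_
  simp only [HSW, Tkin, Function.update_self, ne_eq, Fin.reduceEq, not_false_eq_true,
    Function.update_of_ne]
  refine ((((((((hasDerivAt_id (x 3)).pow 2).add_const _).add_const _).const_mul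
    (1 / 2 : ℝ)).add_const _).add_const _)).congr_deriv ?_
  simp

theorem pd_zero_HSW (hκ₂ : κ₂ ≠ 0) (hx : x ∈ D κ₁ κ₂) (β₀ β₁ β₂ β₃ : ℝ) :
    pd (HSW κ₁ κ₂ β₀ β₁ β₂ β₃) 0 x
      = β₀ * deriv (fun t => Tk κ₁ t ^ 2) (x 0)
        - Ck κ₁ (x 0) / (κ₂ * Sk κ₁ (x 0) ^ 3) * I123 κ₂ β₁ β₂ β₃ x := by
  have hH := differentiableAt_HSW hκ₂ hx β₀ β₁ β₂ β₃
  obtain ⟨h1, h2, h3, -, -, -⟩ := hx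
  refine pd_eq_of_hasDerivAt hH ?_
  have hT : HasDerivAt (fun t => Tk κ₁ t ^ 2) (deriv (fun t => Tk κ₁ t ^ 2) (x 0)) (x 0) := by
    refine DifferentiableAt.hasDerivAt ?_
    unfold Tk
    fun_prop (disch := simp [*])
  have hS : HasDerivAt (fun t => (Sk κ₁ t ^ 2)⁻¹)
      (-(2 * Sk κ₁ (x 0) * Ck κ₁ (x 0)) / (Sk κ₁ (x 0) ^ 2) ^ 2) (x 0) :=
    (((hasDerivAt_sk κ₁ (x 0)).pow 2).inv (pow_ne_zero 2 h1)).congr_deriv (by simp)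
  convert! ((hT.const_mul β₀).add (hS.const_mul (I123 κ₂ β₁ β₂ β₃ x / (2 * κ₂)))).add_const
    (x 3 ^ 2 / 2) using 1
  · funext t
    simp [HSW, Tkin, I123]
    field_simp
    ring
  · field_simp
    ring

theorem pd_one_I12 (hx : x ∈ D κ₁ κ₂) (β₁ β₂ : ℝ) :
    pd (I12 κ₂ β₁ β₂) 1 x
      = 2 * J12 κ₂ x * (Real.sin (x 2) * x 5 / Sk κ₂ (x 1) ^ 2)
        + deriv (fun t => 2 * β₁ * κ₂ ^ 2 * Tk κ₂ t ^ 2 * Real.cos (x 2) ^ 2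
          + 2 * β₂ * κ₂ / (Tk κ₂ t ^ 2 * Real.cos (x 2) ^ 2)) (x 1) := by
  have hI := differentiableAt_I12 hx β₁ β₂
  obtain ⟨-, -, h3, h4, h5, -⟩ := hx
  refine pd_eq_of_hasDerivAt hI ?_
  have hV : DifferentiableAt ℝ (fun t => 2 * β₁ * κ₂ ^ 2 * Tk κ₂ t ^ 2 * Real.cos (x 2) ^ 2
      + 2 * β₂ * κ₂ / (Tk κ₂ t ^ 2 * Real.cos (x 2) ^ 2)) (x 1) := by
    unfold Tk
    fun_prop (disch := simp [*])
  have hJ := (((hasDerivAt_inv_tk h3).const_mul (-(Real.sin (x 2) * x 5))).const_add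
    (Real.cos (x 2) * x 4)).pow 2
  convert! hJ.add hV.hasDerivAt using 1
  · funext t
    simp [I12]
    ring
  · rw [J12]
    push_cast
    ring

theorem pd_four_I12 (hx : x ∈ D κ₁ κ₂) (β₁ β₂ : ℝ) :
    pd (I12 κ₂ β₁ β₂) 4 x = 2 * J12 κ₂ x * Real.cos (x 2) := by
  refine pd_eq_of_hasDerivAt (differentiableAt_I12 hx β₁ β₂) ?_
  convert hasDerivAt_affine_sq_add (Real.cos (x 2)) (-(Real.sin (x 2) / Tk κ₂ (x 1) * x 5))
    (2 * β₁ * κ₂ ^ 2 * Tk κ₂ (x 1) ^ 2 * Real.cos (x 2) ^ 2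
      + 2 * β₂ * κ₂ / (Tk κ₂ (x 1) ^ 2 * Real.cos (x 2) ^ 2)) (x 4) using 1
  · funext t
    simp [I12]
    ring
  · rw [J12]
    ring

theorem pd_five_I23 (hx : x ∈ D κ₁ κ₂) (β₂ β₃ : ℝ) :
    pd (I23 κ₂ β₂ β₃) 5 x = 2 * x 5 := by
  refine pd_eq_of_hasDerivAt (differentiableAt_I23 hx β₂ β₃) ?_
  simp only [I23, Function.update_self, ne_eq, Fin.reduceEq, not_false_eq_true,
    Function.update_of_ne]
  exact ((((hasDerivAt_id (x 5)).pow 2).add_const _).add_const _).congr_deriv (by simp)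

theorem pd_four_I123 (hx : x ∈ D κ₁ κ₂) (β₁ β₂ β₃ : ℝ) :
    pd (I123 κ₂ β₁ β₂ β₃) 4 x = 2 * x 4 := by
  refine pd_eq_of_hasDerivAt (differentiableAt_I123 hx β₁ β₂ β₃) ?_
  simp only [I123, Function.update_self, ne_eq, Fin.reduceEq, not_false_eq_true,
    Function.update_of_ne]
  exact ((((((hasDerivAt_id (x 4)).pow 2).add_const _).add_const _).add_const _).add_const
    _).congr_deriv (by simp)

theorem pd_one_I123 (hx : x ∈ D κ₁ κ₂) (β₁ β₂ β₃ : ℝ) :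
    pd (I123 κ₂ β₁ β₂ β₃) 1 x
      = deriv (fun t => (x 5) ^ 2 / Sk κ₂ t ^ 2 + 2 * β₁ * κ₂ / Ck κ₂ t ^ 2
          + 2 * β₂ * κ₂ / (Sk κ₂ t ^ 2 * Real.cos (x 2) ^ 2)
          + 2 * β₃ * κ₂ / (Sk κ₂ t ^ 2 * Real.sin (x 2) ^ 2)) (x 1) := by
  have hI := differentiableAt_I123 hx β₁ β₂ β₃
  obtain ⟨-, -, h3, h4, h5, h6⟩ := hx
  refine pd_eq_of_hasDerivAt hI ?_
  have hV : DifferentiableAt ℝ (fun t => (x 5) ^ 2 / Sk κ₂ t ^ 2 + 2 * β₁ * κ₂ / Ck κ₂ t ^ 2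
      + 2 * β₂ * κ₂ / (Sk κ₂ t ^ 2 * Real.cos (x 2) ^ 2)
      + 2 * β₃ * κ₂ / (Sk κ₂ t ^ 2 * Real.sin (x 2) ^ 2)) (x 1) := by
    fun_prop (disch := simp [*])
  convert! hV.hasDerivAt.const_add ((x 4) ^ 2) using 1
  funext t
  simp [I123]
  ring

end Gradients

theorem linearIndependent_grad {κ₁ κ₂ : ℝ} (hκ₂ : κ₂ ≠ 0) {x : Pt} (hx : x ∈ D κ₁ κ₂)
    {β₀ β₁ β₂ β₃ : ℝ} {f : Pt → ℝ} (hf : pd f 3 x ≠ 0) (hr : x 3 = 0) (hφ : x 5 ≠ 0)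
    (hH : pd (HSW κ₁ κ₂ β₀ β₁ β₂ β₃) 0 x ≠ 0)
    (hdet : pd (I12 κ₂ β₁ β₂) 1 x * pd (I123 κ₂ β₁ β₂ β₃) 4 x
      - pd (I12 κ₂ β₁ β₂) 4 x * pd (I123 κ₂ β₁ β₂ β₃) 1 x ≠ 0) :
    LinearIndependent ℝ ![grad f x, grad (I12 κ₂ β₁ β₂) x, grad (I23 κ₂ β₂ β₃) x,
      grad (I123 κ₂ β₁ β₂ β₃) x, grad (HSW κ₁ κ₂ β₀ β₁ β₂ β₃) x] := by
  refine linearIndependent_of_sparse hf ?_ ?_ ?_ ((pd_three_HSW hκ₂ hx _ _ _ _).trans hr)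
    ?_ ?_ ?_ hH ?_ ?_ ?_ hdet
  case refine_9 => simpa [grad, pd_five_I23 hx] using hφ
  all_goals
    refine pd_eq_zero_of_update (fun y t => ?_) x
    simp [I12, I23, I123]

/-- for each fixed i ∈ {1,2,3}, the five functions
I₀ᵢ, I₁₂, I₂₃, I₁₂₃, H^SW are functionally independent on D; hence H^SW is a
maximally superintegrable Hamiltonian. -/
theorem SW_maximal_superintegrability (κ₁ κ₂ : ℝ) (hκ₂ : κ₂ ≠ 0) (β₀ β₁ β₂ β₃ : ℝ) :
    (∃ x ∈ D κ₁ κ₂, LinearIndependent ℝ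
      ![grad (I01 κ₁ κ₂ β₀ β₁) x, grad (I12 κ₂ β₁ β₂) x, grad (I23 κ₂ β₂ β₃) x,
        grad (I123 κ₂ β₁ β₂ β₃) x, grad (HSW κ₁ κ₂ β₀ β₁ β₂ β₃) x]) ∧
    (∃ x ∈ D κ₁ κ₂, LinearIndependent ℝ
      ![grad (I02 κ₁ κ₂ β₀ β₂) x, grad (I12 κ₂ β₁ β₂) x, grad (I23 κ₂ β₂ β₃) x,
        grad (I123 κ₂ β₁ β₂ β₃) x, grad (HSW κ₁ κ₂ β₀ β₁ β₂ β₃) x]) ∧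
    (∃ x ∈ D κ₁ κ₂, LinearIndependent ℝ
      ![grad (I03 κ₁ κ₂ β₀ β₃) x, grad (I12 κ₂ β₁ β₂) x, grad (I23 κ₂ β₂ β₃) x,
        grad (I123 κ₂ β₁ β₂ β₃) x, grad (HSW κ₁ κ₂ β₀ β₁ β₂ β₃) x]) := by
  obtain ⟨r, hs, hc⟩ := exists_sk_ne_zero_and_ck_ne_zero κ₁
  obtain ⟨θ, hS, hC⟩ := exists_sk_ne_zero_and_ck_ne_zero κ₂
  obtain ⟨φ, ha, hb⟩ : ∃ φ : ℝ, Real.cos φ ≠ 0 ∧ Real.sin φ ≠ 0 :=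
    ⟨Real.pi / 4, by simp, by simp⟩
  have hT : Tk κ₁ r ≠ 0 := div_ne_zero hs hc
  have hx (p : ℝ) : (![r, θ, φ, 0, p, 1] : Pt) ∈ D κ₁ κ₂ := ⟨hs, hc, hS, hC, ha, hb⟩
  have e1 : ∀ᶠ p in Filter.atTop, J01 κ₁ κ₂ ![r, θ, φ, 0, p, 1] ≠ 0 := by
    filter_upwards [eventually_quadratic_ne_zero (a := 0) (b := -(Sk κ₂ θ / Tk κ₁ r)) (c := 0)
      (.inr (by simp [hS, hT]))] with p hp
    convert hp using 1
    simp [J01]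
  have e2 : ∀ᶠ p in Filter.atTop, J02 κ₁ κ₂ ![r, θ, φ, 0, p, 1] ≠ 0 := by
    filter_upwards [eventually_quadratic_ne_zero (a := 0) (b := Ck κ₂ θ * Real.cos φ / Tk κ₁ r)
      (c := -(Real.sin φ / (Tk κ₁ r * Sk κ₂ θ))) (.inr (by simp [hC, hT, ha]))] with p hp
    convert hp using 1
    simp [J02]
    ring
  have e3 : ∀ᶠ p in Filter.atTop, J03 κ₁ κ₂ ![r, θ, φ, 0, p, 1] ≠ 0 := by
    filter_upwards [eventually_quadratic_ne_zero (a := 0) (b := Ck κ₂ θ * Real.sin φ / Tk κ₁ r)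
      (c := Real.cos φ / (Tk κ₁ r * Sk κ₂ θ)) (.inr (by simp [hC, hT, hb]))] with p hp
    convert hp using 1
    simp [J03]
  have eH : ∀ᶠ p in Filter.atTop,
      pd (HSW κ₁ κ₂ β₀ β₁ β₂ β₃) 0 ![r, θ, φ, 0, p, 1] ≠ 0 := by
    filter_upwards [eventually_quadratic_ne_zero (a := -(Ck κ₁ r / (κ₂ * Sk κ₁ r ^ 3))) (b := 0)
      (c := β₀ * deriv (fun t => Tk κ₁ t ^ 2) r
        - Ck κ₁ r / (κ₂ * Sk κ₁ r ^ 3) * I123 κ₂ β₁ β₂ β₃ ![r, θ, φ, 0, 0, 1])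
      (.inl (by simp [hκ₂, hs, hc]))] with p hp
    convert hp using 1
    rw [pd_zero_HSW hκ₂ (hx p)]
    simp [I123]
    ring
  have ed : ∀ᶠ p in Filter.atTop,
      pd (I12 κ₂ β₁ β₂) 1 ![r, θ, φ, 0, p, 1] * pd (I123 κ₂ β₁ β₂ β₃) 4 ![r, θ, φ, 0, p, 1]
        - pd (I12 κ₂ β₁ β₂) 4 ![r, θ, φ, 0, p, 1]
          * pd (I123 κ₂ β₁ β₂ β₃) 1 ![r, θ, φ, 0, p, 1] ≠ 0 := by
    let k := Real.sin φ / Tk κ₂ θ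
    let m := Real.sin φ / Sk κ₂ θ ^ 2
    let B := deriv (fun t => 2 * β₁ * κ₂ ^ 2 * Tk κ₂ t ^ 2 * Real.cos φ ^ 2
      + 2 * β₂ * κ₂ / (Tk κ₂ t ^ 2 * Real.cos φ ^ 2)) θ
    let E := deriv (fun t => (1 : ℝ) ^ 2 / Sk κ₂ t ^ 2 + 2 * β₁ * κ₂ / Ck κ₂ t ^ 2
      + 2 * β₂ * κ₂ / (Sk κ₂ t ^ 2 * Real.cos φ ^ 2)
      + 2 * β₃ * κ₂ / (Sk κ₂ t ^ 2 * Real.sin φ ^ 2)) θ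
    filter_upwards [eventually_quadratic_ne_zero (a := 4 * Real.cos φ * m)
      (b := -4 * k * m + 2 * B - 2 * Real.cos φ ^ 2 * E) (c := 2 * k * Real.cos φ * E)
      (.inl (by simp [m, ha, hb, hS]))] with p hp
    convert hp using 1
    rw [pd_one_I12 (hx p), pd_four_I12 (hx p), pd_one_I123 (hx p), pd_four_I123 (hx p)]
    change (2 * (Real.cos φ * p - k * 1) * (Real.sin φ * 1 / Sk κ₂ θ ^ 2) + B) * (2 * p)
      - 2 * (Real.cos φ * p - k * 1) * Real.cos φ * E = _
    simp only [m]
    ring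
  obtain ⟨p, h1, h2, h3, hH, hd⟩ := (e1.and (e2.and (e3.and (eH.and ed)))).exists
  refine ⟨⟨_, hx p, linearIndependent_grad hκ₂ (hx p) ?_ rfl one_ne_zero hH hd⟩,
    ⟨_, hx p, linearIndependent_grad hκ₂ (hx p) ?_ rfl one_ne_zero hH hd⟩,
    ⟨_, hx p, linearIndependent_grad hκ₂ (hx p) ?_ rfl one_ne_zero hH hd⟩⟩
  · rw [pd_three_I01 (hx p)]
    exact mul_ne_zero (mul_ne_zero two_ne_zero h1) hC
  · rw [pd_three_I02 (hx p)]
    exact mul_ne_zero (mul_ne_zero two_ne_zero h2) (mul_ne_zero (mul_ne_zero hκ₂ hS) ha)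
  · rw [pd_three_I03 (hx p)]
    exact mul_ne_zero (mul_ne_zero two_ne_zero h3) (mul_ne_zero (mul_ne_zero hκ₂ hS) hb)

end
end Paper
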